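/- arXiv:1510.05117 — 2 statements merged into one kernel-verified Lean document; each statement's English description precedes it below -/
import Mathlib

section
/- For any graph G and any integer k ≥ 1 and any i with 1 ≤ i ≤ k, the number 4·cos²(πi/(2k+1)) is a signless Laplacian eigenvalue of G with multiplicity at least p_k(G) − q_k(G). -/
open Matrix Polynomial Real

/-- A walk `w` from `u` to `v` is a pendant path of length `k` if it is a path of length
`k`, its end `u` has degree `1`, its end `v` has degree at least `3`, and all internal
vertices have degree `2`. -/
def IsPendantPath {V : Type*} [Fintype V] [DecidableEq V] (G : SimpleGraph V)
    [DecidableRel G.Adj] {u v : V} (w : G.Walk u v) (k : ℕ) : Prop :=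
  w.IsPath ∧ w.length = k ∧ G.degree u = 1 ∧ 3 ≤ G.degree v ∧
    ∀ x ∈ w.support, x ≠ u → x ≠ v → G.degree x = 2

/-- `pendantPathCount G k` is `p_k(G)`, the number of pendant paths of length `k` of `G`. -/
noncomputable def pendantPathCount {V : Type*} [Fintype V] [DecidableEq V]
    (G : SimpleGraph V) [DecidableRel G.Adj] (k : ℕ) : ℕ :=
  Nat.card {p : (u : V) × (v : V) × G.Walk u v // IsPendantPath G p.2.2 k}

/-- `pendantAttachCount G k` is `q_k(G)`, the number of vertices of degree at least `3`
which are an end vertex of some pendant path of length `k`. -/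
noncomputable def pendantAttachCount {V : Type*} [Fintype V] [DecidableEq V]
    (G : SimpleGraph V) [DecidableRel G.Adj] (k : ℕ) : ℕ :=
  Nat.card {v : V // 3 ≤ G.degree v ∧ ∃ u, ∃ w : G.Walk u v, IsPendantPath G w k}

lemma neighborFinset_eq_singleton_of_degree_eq_one {V : Type*} [Fintype V]
    {G : SimpleGraph V} [DecidableRel G.Adj] {x y : V} (hx : G.degree x = 1)
    (hy : G.Adj x y) : G.neighborFinset x = {y} := by
  symm
  apply Finset.eq_of_subset_of_card_le
  · simpa
  · rw [G.card_neighborFinset_eq_degree, hx, Finset.card_singleton]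

section PendantPath

variable {V : Type*} [Fintype V] [DecidableEq V] {G : SimpleGraph V} [DecidableRel G.Adj]

/-- The signless Laplacian matrix of a graph, the sum of its degree and adjacency matrices. -/
def signlessLapMatrix (G : SimpleGraph V) [DecidableRel G.Adj] : Matrix V V ℝ :=
  Matrix.diagonal (fun v => (G.degree v : ℝ)) + G.adjMatrix ℝ

lemma signlessLapMatrix_mulVec_single (x : V) :
    signlessLapMatrix G *ᵥ Pi.single x 1 =
      (G.degree x : ℝ) • Pi.single x 1 + ∑ y ∈ G.neighborFinset x, Pi.single y (1 : ℝ) := by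
  ext z
  simp [signlessLapMatrix, Pi.single_apply, Matrix.diagonal_apply, G.adj_comm x z,
    SimpleGraph.adjMatrix_apply, Finset.sum_apply, eq_comm]
  grind

lemma neighborFinset_eq_pair_of_degree_eq_two {x y z : V} (hx : G.degree x = 2)
    (hy : G.Adj x y) (hz : G.Adj x z) (hyz : y ≠ z) : G.neighborFinset x = {y, z} := by
  symm
  apply Finset.eq_of_subset_of_card_le
  · intro a ha
    simp only [Finset.mem_insert, Finset.mem_singleton] at ha
    rcases ha with rfl | rfl <;> simpa
  · rw [G.card_neighborFinset_eq_degree, hx, Finset.card_pair hyz]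

namespace IsPendantPath

variable {u v : V} {w : G.Walk u v} {k : ℕ}

lemma getVert_ne (h : IsPendantPath G w k) {i j : ℕ} (hi : i ≤ k) (hj : j ≤ k) (hij : i ≠ j) :
    w.getVert i ≠ w.getVert j := by
  intro he
  exact hij (h.1.getVert_injOn (by simpa [h.2.1] using hi) (by simpa [h.2.1] using hj) he)

lemma adj_getVert (h : IsPendantPath G w k) {i : ℕ} (hi : i < k) :
    G.Adj (w.getVert i) (w.getVert (i + 1)) :=
  w.adj_getVert_succ (by rw [h.2.1]; exact hi)

lemma getVert_length_eq (h : IsPendantPath G w k) : w.getVert k = v := by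
  rw [← h.2.1, w.getVert_length]

lemma degree_getVert_eq_two (h : IsPendantPath G w k) {i : ℕ} (hi : 0 < i) (hik : i < k) :
    G.degree (w.getVert i) = 2 := by
  refine h.2.2.2.2 _ (w.getVert_mem_support i) ?_ ?_
  · simpa using h.getVert_ne hik.le (Nat.zero_le k) hi.ne'
  · simpa [h.getVert_length_eq] using h.getVert_ne hik.le le_rfl hik.ne

lemma neighborFinset_start (h : IsPendantPath G w k) (hk : 0 < k) :
    G.neighborFinset u = {w.getVert 1} :=
  neighborFinset_eq_singleton_of_degree_eq_one h.2.2.1 (by simpa using h.adj_getVert hk)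

lemma neighborFinset_getVert_succ (h : IsPendantPath G w k) {i : ℕ} (hi : i + 1 < k) :
    G.neighborFinset (w.getVert (i + 1)) = {w.getVert i, w.getVert (i + 2)} :=
  neighborFinset_eq_pair_of_degree_eq_two (h.degree_getVert_eq_two i.succ_pos hi)
    (h.adj_getVert (by omega)).symm (h.adj_getVert hi)
    (h.getVert_ne (by omega) (by omega) (by omega))

/-- The pendant paths of length `k` are determined by their leaf, vertex by vertex. -/
lemma getVert_eq {v' : V} {w' : G.Walk u v'} (h : IsPendantPath G w k)
    (h' : IsPendantPath G w' k) (j : ℕ) :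
    (j ≤ k → w.getVert j = w'.getVert j) ∧
      (j + 1 ≤ k → w.getVert (j + 1) = w'.getVert (j + 1)) := by
  induction j with
  | zero =>
    refine ⟨by simp, fun hk => ?_⟩
    have := (h.neighborFinset_start (by omega)).symm.trans (h'.neighborFinset_start (by omega))
    simpa using this
  | succ j ih =>
    refine ⟨ih.2, fun hj => ?_⟩
    have e := h.neighborFinset_getVert_succ (i := j) (by omega)
    rw [ih.2 (by omega), h'.neighborFinset_getVert_succ (by omega), ih.1 (by omega)] at e
    have hmem : w.getVert (j + 2) ∈ ({w'.getVert j, w'.getVert (j + 2)} : Finset V) := by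
      rw [e]; simp
    have hne := h.getVert_ne (i := j + 2) (j := j) (by omega) (by omega) (by omega)
    rw [ih.1 (by omega)] at hne
    simpa [hne] using hmem

lemma sigma_eq {p q : (u : V) × (v : V) × G.Walk u v} (hp : IsPendantPath G p.2.2 k)
    (hq : IsPendantPath G q.2.2 k) (hpq : p.1 = q.1) : p = q := by
  obtain ⟨u, v, w⟩ := p
  obtain ⟨u', v', w'⟩ := q
  obtain rfl : u = u' := hpq
  obtain rfl : v = v' :=
    hp.getVert_length_eq.symm.trans
      (((hp.getVert_eq hq k).1 le_rfl).trans hq.getVert_length_eq)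
  obtain rfl : w = w' := SimpleGraph.Walk.ext_getVert_le_length (hp.2.1.trans hq.2.1.symm)
    fun j hj => (hp.getVert_eq hq j).1 (hj.trans_eq hp.2.1)
  rfl

end IsPendantPath

/-- The vector with value `f j` at the `j`-th vertex of the walk `w`, for `j < n`. -/
noncomputable def walkVector {u v : V} (w : G.Walk u v) (f : ℕ → ℝ) (n : ℕ) : V → ℝ :=
  ∑ j ∈ Finset.range n, f j • Pi.single (w.getVert j) 1

namespace IsPendantPath

variable {u v : V} {w : G.Walk u v} {k : ℕ}

lemma signlessLapMatrix_mulVec_walkVector (h : IsPendantPath G w k) {f : ℕ → ℝ} {θ : ℝ}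
    (h0 : f 1 = (θ - 1) * f 0) (hf : ∀ j, f (j + 2) = (θ - 2) * f (j + 1) - f j)
    {n : ℕ} (hn : n < k) :
    signlessLapMatrix G *ᵥ walkVector w f (n + 1) = θ • walkVector w f (n + 1) +
      (f n • Pi.single (w.getVert (n + 1)) 1 - f (n + 1) • Pi.single (w.getVert n) 1) := by
  induction n with
  | zero =>
    simp only [walkVector, zero_add, Finset.sum_range_one, SimpleGraph.Walk.getVert_zero,
      Matrix.mulVec_smul, signlessLapMatrix_mulVec_single, h.2.2.1, h.neighborFinset_start hn,
      Finset.sum_singleton, h0]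
    ext x
    simp only [Pi.add_apply, Pi.sub_apply, Pi.smul_apply, smul_eq_mul]
    push_cast
    ring
  | succ n ih =>
    have hs : walkVector w f (n + 1 + 1) =
        walkVector w f (n + 1) + f (n + 1) • Pi.single (w.getVert (n + 1)) 1 :=
      Finset.sum_range_succ _ _
    rw [hs, Matrix.mulVec_add, ih (by omega), Matrix.mulVec_smul,
      signlessLapMatrix_mulVec_single, h.degree_getVert_eq_two n.succ_pos hn,
      h.neighborFinset_getVert_succ hn,
      Finset.sum_pair (h.getVert_ne (by omega) (by omega) (by omega)), hf n]
    ext x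
    simp only [Pi.add_apply, Pi.sub_apply, Pi.smul_apply, smul_eq_mul]
    push_cast
    ring

lemma walkVector_apply_start (h : IsPendantPath G w k) (hk : 0 < k) (f : ℕ → ℝ) :
    walkVector w f k u = f 0 := by
  simp only [walkVector, Finset.sum_apply, Pi.smul_apply, smul_eq_mul]
  rw [Finset.sum_eq_single_of_mem 0 (by simpa using hk)]
  · simp
  · intro j hj hj0
    have := h.getVert_ne (Finset.mem_range.1 hj).le (Nat.zero_le k) hj0
    rw [w.getVert_zero] at this
    rw [Pi.single_eq_of_ne this.symm, mul_zero]

lemma walkVector_apply_of_degree_eq_one (h : IsPendantPath G w k) {x : V}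
    (hx : G.degree x = 1) (hxu : x ≠ u) (f : ℕ → ℝ) : walkVector w f k x = 0 := by
  simp only [walkVector, Finset.sum_apply, Pi.smul_apply, smul_eq_mul]
  refine Finset.sum_eq_zero fun j hj => ?_
  rw [Pi.single_eq_of_ne, mul_zero]
  rintro rfl
  rcases Nat.eq_zero_or_pos j with rfl | hj0
  · simp at hxu
  · have := h.degree_getVert_eq_two hj0 (Finset.mem_range.1 hj)
    omega

end IsPendantPath

/-- If the two-term recurrence of the signless Laplacian along a pendant path has a solution
`f` with `f 0 ≠ 0` and `f k = 0`, then its parameter `θ` is a signless Laplacian eigenvalue of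
multiplicity at least `p_k(G) - q_k(G)`. -/
theorem pendantPathCount_sub_le_rootMultiplicity {k : ℕ} (hk : 1 ≤ k) {f : ℕ → ℝ} {θ : ℝ}
    (h0 : f 1 = (θ - 1) * f 0) (hf : ∀ j, f (j + 2) = (θ - 2) * f (j + 1) - f j)
    (hf0 : f 0 ≠ 0) (hfk : f k = 0) :
    pendantPathCount G k - pendantAttachCount G k ≤
      (signlessLapMatrix G).charpoly.rootMultiplicity θ := by
  classical
  let P := {p : (u : V) × (v : V) × G.Walk u v // IsPendantPath G p.2.2 k}
  let A := {v : V // 3 ≤ G.degree v ∧ ∃ u, ∃ w : G.Walk u v, IsPendantPath G w k}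
  have hinj : Function.Injective (fun p : P => p.1.1) := fun p q hpq =>
    Subtype.ext (p.2.sigma_eq q.2 hpq)
  have : Finite P := Finite.of_injective _ hinj
  have : Fintype P := Fintype.ofFinite P
  let g : P → V → ℝ := fun p => walkVector p.1.2.2 f k
  have hg (p : P) : signlessLapMatrix G *ᵥ g p = θ • g p + f (k - 1) • Pi.single p.1.2.1 1 := by
    obtain ⟨m, rfl⟩ : ∃ m, k = m + 1 := ⟨k - 1, by omega⟩
    have := p.2.signlessLapMatrix_mulVec_walkVector h0 hf (n := m) (by omega)
    simpa [g, hfk, p.2.getVert_length_eq] using this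
  have hli : LinearIndependent ℝ g := by
    rw [Fintype.linearIndependent_iff]
    intro c hc p
    have := congrFun hc p.1.1
    rw [Finset.sum_apply, Finset.sum_eq_single_of_mem p (Finset.mem_univ p)] at this
    · simpa [g, p.2.walkVector_apply_start hk, hf0] using this
    · intro q _ hq
      simp [g, q.2.walkVector_apply_of_degree_eq_one p.2.2.2.1 fun e => hq (hinj e.symm)]
  let T : (P → ℝ) →ₗ[ℝ] V → ℝ := Fintype.linearCombination ℝ g
  have hT : Function.Injective T := hli.fintypeLinearCombination_injective
  let S : (P → ℝ) →ₗ[ℝ] A → ℝ :=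
    { toFun := fun c a => ∑ p : P, c p * (Pi.single p.1.2.1 1 : V → ℝ) a
      map_add' := fun c d => by ext a; simp [add_mul, Finset.sum_add_distrib]
      map_smul' := fun r c => by ext a; simp [mul_assoc, Finset.mul_sum] }
  have hker : (LinearMap.ker S).map T ≤
      Module.End.eigenspace (Matrix.toLin' (signlessLapMatrix G)) θ := by
    rintro _ ⟨c, hc, rfl⟩
    have hc0 : ∑ p : P, c p • (Pi.single p.1.2.1 1 : V → ℝ) = 0 := by
      ext x
      by_cases hx : ∃ p : P, p.1.2.1 = x
      · obtain ⟨p, rfl⟩ := hx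
        have := congrFun (LinearMap.mem_ker.1 hc) ⟨p.1.2.1, p.2.2.2.2.1, p.1.1, p.1.2.2, p.2⟩
        simpa [S, Finset.sum_apply] using this
      · push Not at hx
        rw [Finset.sum_apply]
        exact Finset.sum_eq_zero fun p _ => by simp [Pi.single_eq_of_ne (hx p).symm]
    rw [Module.End.mem_eigenspace_iff, Matrix.toLin'_apply]
    simp only [T, Fintype.linearCombination_apply]
    rw [Matrix.mulVec_sum]
    simp only [Matrix.mulVec_smul, hg, smul_add, Finset.sum_add_distrib, smul_comm (c _),
      ← Finset.smul_sum, hc0, smul_zero, add_zero]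
  have hrank := S.finrank_range_add_finrank_ker
  have hrange : Module.finrank ℝ (LinearMap.range S) ≤ Nat.card A := by
    have := Submodule.finrank_le (LinearMap.range S)
    rwa [Module.finrank_fintype_fun_eq_card, ← Nat.card_eq_fintype_card] at this
  rw [Module.finrank_fintype_fun_eq_card, ← Nat.card_eq_fintype_card] at hrank
  calc pendantPathCount G k - pendantAttachCount G k
      = Nat.card P - Nat.card A := rfl
    _ ≤ Module.finrank ℝ (LinearMap.ker S) := by omega
    _ = Module.finrank ℝ ((LinearMap.ker S).map T) :=
        (LinearEquiv.finrank_eq (Submodule.equivMapOfInjective T hT _))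
    _ ≤ _ := Submodule.finrank_mono hker
    _ ≤ (Matrix.toLin' (signlessLapMatrix G)).charpoly.rootMultiplicity θ :=
        LinearMap.finrank_eigenspace_le _ _
    _ = _ := by rw [Matrix.charpoly_toLin']

end PendantPath

/-- For any graph `G`, any `k ≥ 1` and any `1 ≤ i ≤ k`, the number `4 cos²(π i/(2k+1))`
is a signless Laplacian eigenvalue of `G` with multiplicity at least `p_k(G) - q_k(G)`. -/
theorem signless_laplacian_pendant_eigenvalue {V : Type*} [Fintype V] [DecidableEq V]
    (G : SimpleGraph V) [DecidableRel G.Adj] (k i : ℕ) (hk : 1 ≤ k) (hi : 1 ≤ i)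
    (hik : i ≤ k) :
    pendantPathCount G k - pendantAttachCount G k ≤
      Polynomial.rootMultiplicity (4 * Real.cos (π * i / (2 * k + 1)) ^ 2)
        (Matrix.charpoly (Matrix.diagonal (fun v => (G.degree v : ℝ)) + G.adjMatrix ℝ)) := by
  have hpos : (0 : ℝ) < 2 * k + 1 := by positivity
  set x : ℝ := π * i / (2 * k + 1) with hx
  have hx0 : 0 < x := by
    have : (0 : ℝ) < i := by exact_mod_cast hi
    positivity
  have hxπ : x < π := by
    have : (i : ℝ) ≤ k := by exact_mod_cast hik
    rw [hx, div_lt_iff₀ hpos]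
    nlinarith [pi_pos, (Nat.cast_nonneg k : (0 : ℝ) ≤ k)]
  refine pendantPathCount_sub_le_rootMultiplicity (f := fun j : ℕ => sin ((2 * j + 1) * x)) hk
    ?_ (fun j => ?_) ?_ ?_
  · have : (2 * ((1 : ℕ) : ℝ) + 1) * x = 3 * x := by push_cast; ring
    rw [this, sin_three_mul]
    simp only [Nat.cast_zero, mul_zero, zero_add, one_mul, cos_sq']
    ring
  · have h1 : (2 * ((j + 2 : ℕ) : ℝ) + 1) * x = (2 * ((j + 1 : ℕ) : ℝ) + 1) * x + 2 * x := by
      push_cast; ring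
    have h2 : (2 * (j : ℝ) + 1) * x = (2 * ((j + 1 : ℕ) : ℝ) + 1) * x - 2 * x := by
      push_cast; ring
    rw [h1, h2, sin_add, sin_sub, cos_two_mul]
    ring
  · simpa using (sin_pos_of_pos_of_lt_pi hx0 hxπ).ne'
  · have : (2 * (k : ℝ) + 1) * x = i * π := by rw [hx]; field_simp
    simp only [this, sin_nat_mul_pi]
end

section
/- For any positive integer k and any graph G with p_k(G) > q_k(G), G has some Laplacian eigenvalue of multiplicity at least p_k(G) − q_k(G) (Saito–Woei conjecture). -/
open Matrix Polynomial Real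

open Module in
/-- If an endomorphism sends `n` independent vectors into the span of `m` vectors, its kernel
has dimension at least `n - m`. -/
theorem card_sub_card_le_finrank_ker {K M ι κ : Type*} [Field K] [AddCommGroup M] [Module K M]
    [FiniteDimensional K M] [Fintype ι] [Fintype κ] (N : M →ₗ[K] M) (x : ι → M) (e : κ → M)
    (hx : LinearIndependent K x) (h : ∀ i, N (x i) ∈ Submodule.span K (Set.range e)) :
    Fintype.card ι - Fintype.card κ ≤ finrank K (LinearMap.ker N) := by
  set W := Submodule.span K (Set.range x)
  have hrank := LinearMap.finrank_range_add_finrank_ker (N.domRestrict W)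
  have hW : finrank K W = Fintype.card ι := finrank_span_eq_card hx
  have hrange : finrank K (LinearMap.range (N.domRestrict W)) ≤ Fintype.card κ := by
    refine le_trans (Submodule.finrank_mono ?_) (finrank_range_le_card (R := K) e)
    rw [LinearMap.range_domRestrict, Submodule.map_span_le]
    rintro _ ⟨i, rfl⟩
    exact h i
  have hker : finrank K (LinearMap.ker (N.domRestrict W)) ≤ finrank K (LinearMap.ker N) := by
    rw [← Submodule.finrank_map_subtype_eq]
    refine Submodule.finrank_mono ?_
    rintro _ ⟨y, hy, rfl⟩
    simpa using hy
  omega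

section PendantPath

variable {V : Type*} [Fintype V] [DecidableEq V] {G : SimpleGraph V} [DecidableRel G.Adj]
  {u v : V} {w : G.Walk u v} {k : ℕ}

theorem IsPendantPath.getVert_inj (hw : IsPendantPath G w k) {i j : ℕ} (hi : i ≤ k) (hj : j ≤ k)
    (h : w.getVert i = w.getVert j) : i = j :=
  hw.1.getVert_injOn (by simpa [hw.2.1] using hi) (by simpa [hw.2.1] using hj) h

theorem IsPendantPath.adj_getVert_succ (hw : IsPendantPath G w k) {i : ℕ} (hi : i < k) :
    G.Adj (w.getVert i) (w.getVert (i + 1)) :=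
  w.adj_getVert_succ (by rw [hw.2.1]; exact hi)

theorem IsPendantPath.getVert_length (hw : IsPendantPath G w k) : w.getVert k = v := by
  rw [← hw.2.1, SimpleGraph.Walk.getVert_length]

theorem IsPendantPath.degree_getVert (hw : IsPendantPath G w k) {i : ℕ} (h0 : i ≠ 0)
    (hi : i < k) : G.degree (w.getVert i) = 2 := by
  refine hw.2.2.2.2 _ (w.getVert_mem_support i) (fun h => h0 ?_) (fun h => hi.ne ?_)
  · exact hw.getVert_inj hi.le (Nat.zero_le k) (by rw [h, w.getVert_zero])
  · exact hw.getVert_inj hi.le le_rfl (by rw [h, hw.getVert_length])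

theorem IsPendantPath.neighborFinset_start_s12 (hw : IsPendantPath G w k) (hk : 0 < k) :
    G.neighborFinset (w.getVert 0) = {w.getVert 1} := by
  symm
  refine Finset.eq_of_subset_of_card_le ?_ ?_
  · simpa using hw.adj_getVert_succ hk
  · rw [G.card_neighborFinset_eq_degree, w.getVert_zero, hw.2.2.1, Finset.card_singleton]

theorem IsPendantPath.neighborFinset_getVert_succ_s12 (hw : IsPendantPath G w k) {i : ℕ}
    (hi : i + 1 < k) :
    G.neighborFinset (w.getVert (i + 1)) = {w.getVert i, w.getVert (i + 2)} := by
  symm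
  refine Finset.eq_of_subset_of_card_le ?_ ?_
  · intro x hx
    rw [G.mem_neighborFinset]
    rcases Finset.mem_insert.1 hx with rfl | hx
    · exact (hw.adj_getVert_succ (by omega)).symm
    · rw [Finset.mem_singleton.1 hx]
      exact hw.adj_getVert_succ hi
  · rw [G.card_neighborFinset_eq_degree, hw.degree_getVert (Nat.succ_ne_zero i) hi,
      Finset.card_pair]
    intro h
    have := hw.getVert_inj (by omega) (by omega) h
    omega

/-- A pendant path is determined by its pendant vertex and its length. -/
theorem IsPendantPath.getVert_eq_s12 {v' : V} {w' : G.Walk u v'} (hw : IsPendantPath G w k)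
    (hw' : IsPendantPath G w' k) : ∀ i ≤ k, w.getVert i = w'.getVert i
  | 0, _ => by simp
  | 1, hi => by
    have h := hw.neighborFinset_start_s12 hi
    have h' := hw'.neighborFinset_start_s12 hi
    rw [w.getVert_zero] at h
    rw [w'.getVert_zero] at h'
    exact Finset.singleton_injective (h.symm.trans h')
  | i + 2, hi => by
    have h0 := hw.getVert_eq_s12 hw' i (by omega)
    have h1 := hw.getVert_eq_s12 hw' (i + 1) (by omega)
    have hmem : w.getVert (i + 2) ∈ G.neighborFinset (w'.getVert (i + 1)) := by
      rw [← h1, hw.neighborFinset_getVert_succ_s12 (by omega)]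
      simp
    rw [hw'.neighborFinset_getVert_succ_s12 (by omega), ← h0, Finset.mem_insert,
      Finset.mem_singleton] at hmem
    refine hmem.resolve_left fun h => ?_
    have := hw.getVert_inj hi (by omega) h
    omega

theorem pendantPath_eq_of_start_eq
    {p q : {p : (u : V) × (v : V) × G.Walk u v // IsPendantPath G p.2.2 k}}
    (h : p.1.1 = q.1.1) : p = q := by
  obtain ⟨⟨u, v, w⟩, hw⟩ := p
  obtain ⟨⟨u', v', w'⟩, hw'⟩ := q
  dsimp only at h hw hw'
  subst h
  have hv : v = v' := by
    rw [← hw.getVert_length, ← hw'.getVert_length, hw.getVert_eq_s12 hw' k le_rfl]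
  subst hv
  have hww : w = w' := by
    refine SimpleGraph.Walk.ext_getVert_le_length (hw.2.1.trans hw'.2.1.symm) fun i hi => ?_
    exact hw.getVert_eq_s12 hw' i (hw.2.1 ▸ hi)
  subst hww
  rfl

variable (G) in
/-- The Laplacian matrix applied to a basis vector. -/
theorem laplacian_mulVec_single (y : V) :
    (Matrix.diagonal (fun v => (G.degree v : ℝ)) - G.adjMatrix ℝ) *ᵥ Pi.single y 1 =
      (G.degree y : ℝ) • Pi.single y 1 - ∑ z ∈ G.neighborFinset y, Pi.single z (1 : ℝ) := by
  ext x
  rw [Matrix.mulVec_single_one]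
  by_cases hxy : x = y
  · subst hxy
    simp [Finset.sum_apply, Pi.single_apply]
  · simp [Finset.sum_apply, Pi.single_apply, hxy, G.adj_comm]

/-- The vector supported on a pendant path, without its last vertex, whose entries there are
`c 0, c 1, …`. -/
noncomputable def pendantVector {u v : V} (w : G.Walk u v) (c : ℕ → ℝ) (n : ℕ) : V → ℝ :=
  ∑ i ∈ Finset.range n, c i • Pi.single (w.getVert i) 1

theorem IsPendantPath.laplacian_mulVec_pendantVector (hw : IsPendantPath G w k)
    {c : ℕ → ℝ} {θ : ℝ} (h0 : c 1 = (1 - θ) * c 0) (hc : ∀ i, c (i + 2) = (2 - θ) * c (i + 1) - c i) (n : ℕ)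
    (hn : n < k) :
    (Matrix.diagonal (fun v => (G.degree v : ℝ)) - G.adjMatrix ℝ) *ᵥ pendantVector w c (n + 1) =
      θ • pendantVector w c (n + 1) + c (n + 1) • Pi.single (w.getVert n) 1 -
        c n • Pi.single (w.getVert (n + 1)) 1 := by
  induction n with
  | zero =>
    simp only [pendantVector, zero_add, Finset.sum_range_one]
    rw [Matrix.mulVec_smul, laplacian_mulVec_single, hw.neighborFinset_start_s12 hn, h0,
      Finset.sum_singleton, w.getVert_zero, hw.2.2.1]
    push_cast
    module
  | succ n ih =>
    have hstep : pendantVector w c (n + 1 + 1) =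
        pendantVector w c (n + 1) + c (n + 1) • Pi.single (w.getVert (n + 1)) 1 :=
      Finset.sum_range_succ _ _
    rw [hstep, Matrix.mulVec_add, ih (by omega), Matrix.mulVec_smul, laplacian_mulVec_single,
      hw.neighborFinset_getVert_succ_s12 hn, hw.degree_getVert (Nat.succ_ne_zero n) hn, hc,
      Finset.sum_pair]
    · push_cast
      module
    · intro h
      have := hw.getVert_inj (by omega) (by omega) h
      omega

/-- The entry of the vector of a pendant path at a vertex of degree `1`. -/
theorem IsPendantPath.pendantVector_apply (hw : IsPendantPath G w k) (hk : 0 < k) (c : ℕ → ℝ)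
    {x : V} (hx : G.degree x = 1) : pendantVector w c k x = if x = u then c 0 else 0 := by
  rw [pendantVector, Finset.sum_apply, Finset.sum_eq_single_of_mem 0 (by simpa using hk)]
  · simp [Pi.single_apply]
  · intro i hi h0
    have hne : x ≠ w.getVert i := by
      rintro rfl
      rw [hw.degree_getVert h0 (by simpa using hi)] at hx
      omega
    simp [hne]

end PendantPath

theorem cos_recurrence (a : ℝ) (i : ℕ) :
    cos ((2 * (i + 2 : ℕ) + 1) * a) =
      (2 - (2 - 2 * cos (2 * a))) * cos ((2 * (i + 1 : ℕ) + 1) * a) - cos ((2 * i + 1) * a) := by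
  have h1 : (2 * (i + 2 : ℕ) + 1) * a = (2 * (i + 1 : ℕ) + 1) * a + 2 * a := by
    push_cast; ring
  have h2 : (2 * i + 1) * a = (2 * (i + 1 : ℕ) + 1) * a - 2 * a := by
    push_cast; ring
  rw [h1, h2, cos_add, cos_sub]
  ring

/-- Saito–Woei conjecture: for any positive integer `k` and any graph `G` with
`p_k(G) > q_k(G)`, `G` has some Laplacian eigenvalue of multiplicity at least
`p_k(G) - q_k(G)`. -/
theorem saito_woei_conjecture {V : Type*} [Fintype V] [DecidableEq V]
    (G : SimpleGraph V) [DecidableRel G.Adj] (k : ℕ) (hk : 0 < k)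
    (h : pendantAttachCount G k < pendantPathCount G k) :
    ∃ θ : ℝ, pendantPathCount G k - pendantAttachCount G k ≤
      Polynomial.rootMultiplicity θ
        (Matrix.charpoly (Matrix.diagonal (fun v => (G.degree v : ℝ)) - G.adjMatrix ℝ)) := by
  set L := Matrix.diagonal (fun v => (G.degree v : ℝ)) - G.adjMatrix ℝ
  set a : ℝ := π / (2 * (2 * k + 1)) with ha
  set θ : ℝ := 2 - 2 * cos (2 * a) with hθ
  set c : ℕ → ℝ := fun i => cos ((2 * i + 1) * a) with hcdef
  have hk1 : (1 : ℝ) ≤ k := by exact_mod_cast hk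
  have hc0 : c 0 ≠ 0 := by
    have hpos : 0 < cos a := by
      refine cos_pos_of_mem_Ioo ⟨?_, ?_⟩
      · have : 0 < a := by positivity
        linarith [pi_pos]
      · rw [ha]
        exact div_lt_div_of_pos_left pi_pos two_pos (by linarith)
    simpa [hcdef] using hpos.ne'
  have hck : c k = 0 := by
    have : (2 * k + 1) * a = π / 2 := by
      rw [ha]; field_simp
    simp only [hcdef, this, cos_pi_div_two]
  have hc1 : c 1 = (1 - θ) * c 0 := by
    have h3 : (2 * ((1 : ℕ) : ℝ) + 1) * a = 2 * a + a := by push_cast; ring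
    have h1 : (2 * ((0 : ℕ) : ℝ) + 1) * a = a := by push_cast; ring
    simp only [hcdef, h3, h1, hθ, cos_add, cos_two_mul, sin_two_mul]
    linear_combination (-2 * cos a) * sin_sq_add_cos_sq a
  have hcs : ∀ i, c (i + 2) = (2 - θ) * c (i + 1) - c i := cos_recurrence a
  let P := {p : (u : V) × (v : V) × G.Walk u v // IsPendantPath G p.2.2 k}
  let Q := {v : V // 3 ≤ G.degree v ∧ ∃ u, ∃ w : G.Walk u v, IsPendantPath G w k}
  have : Finite P :=
    Finite.of_injective (fun p : P => p.1.1) fun _ _ h => pendantPath_eq_of_start_eq h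
  have := Fintype.ofFinite P
  have := Fintype.ofFinite Q
  let x : P → V → ℝ := fun p => pendantVector p.1.2.2 c k
  let e : Q → V → ℝ := fun q => Pi.single q.1 1
  have hx : LinearIndependent ℝ x := by
    rw [Fintype.linearIndependent_iff]
    intro g hg q
    have hq := congrFun hg q.1.1
    rw [Finset.sum_apply, Finset.sum_eq_single_of_mem q (Finset.mem_univ q)] at hq
    · simpa [x, q.2.pendantVector_apply hk c q.2.2.2.1, hc0] using hq
    · intro p _ hpq
      have hne : q.1.1 ≠ p.1.1 := fun h => hpq (pendantPath_eq_of_start_eq h.symm)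
      simp [x, p.2.pendantVector_apply hk c q.2.2.2.1, hne]
  have hN : ∀ p : P, (L.toLin' - algebraMap ℝ _ θ) (x p) ∈ Submodule.span ℝ (Set.range e) := by
    intro p
    obtain ⟨n, rfl⟩ : ∃ n, k = n + 1 := ⟨k - 1, by omega⟩
    have hp := p.2.laplacian_mulVec_pendantVector hc1 hcs n (Nat.lt_succ_self n)
    rw [hck, p.2.getVert_length, zero_smul, add_zero] at hp
    have hxp : (L.toLin' - algebraMap ℝ _ θ) (x p) = (-c n) • (Pi.single p.1.2.1 1 : V → ℝ) := by
      simp only [LinearMap.sub_apply, Matrix.toLin'_apply, Module.algebraMap_end_apply, x]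
      rw [hp]
      module
    rw [hxp]
    exact Submodule.smul_mem _ _
      (Submodule.subset_span ⟨⟨p.1.2.1, p.2.2.2.2.1, p.1.1, p.1.2.2, p.2⟩, rfl⟩)
  refine ⟨θ, ?_⟩
  rw [pendantPathCount, pendantAttachCount, Nat.card_eq_fintype_card (α := P),
    Nat.card_eq_fintype_card (α := Q), ← Matrix.charpoly_toLin']
  refine le_trans ?_ (LinearMap.finrank_eigenspace_le _ _)
  rw [Module.End.eigenspace_def]
  exact card_sub_card_le_finrank_ker _ x e hx hN
end
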